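/- arXiv:math/0507318 — 3 statements merged into one kernel-verified Lean document; each statement's English description precedes it below -/
import Mathlib

section
/- Let n ≥ 2 be an integer, let Ω ⊆ ℝⁿ be an open set, and let X : Ω → ℝⁿ be a C¹ vector field such that div X(x) − ‖X(x)‖² ≥ c for all x ∈ Ω, for some constant c ∈ ℝ. Then λ*(Ω) ≥ c; equivalently, for every smooth function φ : ℝⁿ → ℝ with compact support contained in Ω one has ∫_Ω ‖∇φ‖² ≥ c ∫_Ω φ². -/
open scoped ENNReal Topology
open MeasureTheory

/-- The fundamental tone `λ*(Ω)` of an open set `Ω ⊆ ℝⁿ`: the infimum of the Rayleigh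
quotients `∫_Ω ‖∇φ‖² / ∫_Ω φ²` over all smooth functions `φ : ℝⁿ → ℝ`, not identically
zero, with compact support contained in `Ω` (valued in `ℝ≥0∞`; it is `∞` if no such `φ`
exists). -/
noncomputable def lamStar (n : ℕ) (Ω : Set (EuclideanSpace ℝ (Fin n))) : ℝ≥0∞ :=
  ⨅ φ : {φ : EuclideanSpace ℝ (Fin n) → ℝ //
      ContDiff ℝ (⊤ : ℕ∞) φ ∧ HasCompactSupport φ ∧ tsupport φ ⊆ Ω ∧ φ ≠ 0},
    ENNReal.ofReal ((∫ x in Ω, ‖gradient φ.1 x‖ ^ 2) / ∫ x in Ω, φ.1 x ^ 2)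

/-- The divergence of a vector field `X : ℝⁿ → ℝⁿ` at `x`: the trace of its derivative. -/
noncomputable def ediv {n : ℕ} (X : EuclideanSpace ℝ (Fin n) → EuclideanSpace ℝ (Fin n))
    (x : EuclideanSpace ℝ (Fin n)) : ℝ :=
  LinearMap.trace ℝ _ (fderiv ℝ X x).toLinearMap

/-- The Laplacian of `f : ℝⁿ → ℝ` at `x`: the trace of its Hessian, i.e. the divergence
of its gradient. -/
noncomputable def lap {n : ℕ} (f : EuclideanSpace ℝ (Fin n) → ℝ)
    (x : EuclideanSpace ℝ (Fin n)) : ℝ :=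
  LinearMap.trace ℝ _ (fderiv ℝ (gradient f) x).toLinearMap

section Divergence

variable {n : ℕ}

theorem ediv_eq_sum (Y : EuclideanSpace ℝ (Fin n) → EuclideanSpace ℝ (Fin n))
    (x : EuclideanSpace ℝ (Fin n)) :
    ediv Y x = ∑ i, inner ℝ (EuclideanSpace.basisFun (Fin n) ℝ i)
      (fderiv ℝ Y x (EuclideanSpace.basisFun (Fin n) ℝ i)) :=
  LinearMap.trace_eq_sum_inner _ _

theorem integrable_fderiv_apply {Y : EuclideanSpace ℝ (Fin n) → EuclideanSpace ℝ (Fin n)}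
    (hY : ContDiff ℝ 1 Y) (hYc : HasCompactSupport Y) (v : EuclideanSpace ℝ (Fin n)) :
    Integrable (fun x ↦ fderiv ℝ Y x v) :=
  ((hY.continuous_fderiv one_ne_zero).clm_apply continuous_const).integrable_of_hasCompactSupport
    (hYc.fderiv_apply (𝕜 := ℝ) v)

theorem integral_fderiv_apply_eq_zero {Y : EuclideanSpace ℝ (Fin n) → EuclideanSpace ℝ (Fin n)}
    (hY : ContDiff ℝ 1 Y) (hYc : HasCompactSupport Y) (v : EuclideanSpace ℝ (Fin n)) :
    ∫ x, fderiv ℝ Y x v = 0 := by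
  simpa using integral_smul_fderiv_eq_neg_fderiv_smul_of_integrable
    (μ := volume) (f := fun _ ↦ (1 : ℝ)) (g := Y) (v := v) (by simp)
    (by simpa using integrable_fderiv_apply hY hYc v)
    (by simpa using hY.continuous.integrable_of_hasCompactSupport hYc) (by simp)
    (fun x _ ↦ hY.differentiable one_ne_zero x)

theorem integrable_ediv {Y : EuclideanSpace ℝ (Fin n) → EuclideanSpace ℝ (Fin n)}
    (hY : ContDiff ℝ 1 Y) (hYc : HasCompactSupport Y) : Integrable (ediv Y) := by
  rw [funext (ediv_eq_sum Y)]
  exact integrable_finsetSum _ fun i _ ↦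
    (integrable_fderiv_apply hY hYc _).const_inner _

/-- The divergence theorem for compactly supported `C¹` vector fields. -/
theorem integral_ediv_eq_zero {Y : EuclideanSpace ℝ (Fin n) → EuclideanSpace ℝ (Fin n)}
    (hY : ContDiff ℝ 1 Y) (hYc : HasCompactSupport Y) : ∫ x, ediv Y x = 0 := by
  simp_rw [ediv_eq_sum]
  rw [integral_finsetSum _ fun i _ ↦ (integrable_fderiv_apply hY hYc _).const_inner _]
  refine Finset.sum_eq_zero fun i _ ↦ ?_
  rw [integral_inner (integrable_fderiv_apply hY hYc _), integral_fderiv_apply_eq_zero hY hYc,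
    inner_zero_right]

theorem ediv_smul {f : EuclideanSpace ℝ (Fin n) → ℝ}
    {X : EuclideanSpace ℝ (Fin n) → EuclideanSpace ℝ (Fin n)} {x : EuclideanSpace ℝ (Fin n)}
    (hf : DifferentiableAt ℝ f x) (hX : DifferentiableAt ℝ X x) :
    ediv (fun y ↦ f y • X y) x = f x * ediv X x + fderiv ℝ f x (X x) := by
  have h : (fderiv ℝ (fun y ↦ f y • X y) x).toLinearMap =
      f x • (fderiv ℝ X x).toLinearMap + (fderiv ℝ f x).toLinearMap.smulRight (X x) := by
    rw [fderiv_fun_smul hf hX]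
    rfl
  rw [ediv, h, map_add, map_smul, LinearMap.trace_smulRight]
  rfl

end Divergence

theorem contDiff_smul_of_tsupport_subset {E F : Type*} [NormedAddCommGroup E] [NormedSpace ℝ E]
    [NormedAddCommGroup F] [NormedSpace ℝ F] {k : WithTop ℕ∞} {f : E → ℝ} {X : E → F} {Ω : Set E}
    (hΩ : IsOpen Ω) (hf : ContDiff ℝ k f) (hX : ContDiffOn ℝ k X Ω) (hs : tsupport f ⊆ Ω) :
    ContDiff ℝ k fun x ↦ f x • X x := by
  refine contDiff_iff_contDiffAt.2 fun x ↦ ?_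
  by_cases hx : x ∈ tsupport f
  · exact hf.contDiffAt.smul (hX.contDiffAt (hΩ.mem_nhds (hs hx)))
  · refine (contDiffAt_const (c := (0 : F))).congr_of_eventuallyEq ?_
    filter_upwards [notMem_tsupport_iff_eventuallyEq.1 hx] with y hy
    simp [hy]

/-- Barta's inequality for a compactly supported test function. -/
theorem mul_integral_sq_le_integral_norm_gradient_sq {n : ℕ}
    {Ω : Set (EuclideanSpace ℝ (Fin n))} (hΩ : IsOpen Ω)
    {X : EuclideanSpace ℝ (Fin n) → EuclideanSpace ℝ (Fin n)} (hX : ContDiffOn ℝ 1 X Ω)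
    {c : ℝ} (hc : ∀ x ∈ Ω, c ≤ ediv X x - ‖X x‖ ^ 2) {φ : EuclideanSpace ℝ (Fin n) → ℝ}
    (hφ : ContDiff ℝ 1 φ) (hφc : HasCompactSupport φ) (hφΩ : tsupport φ ⊆ Ω) :
    c * ∫ x in Ω, φ x ^ 2 ≤ ∫ x in Ω, ‖gradient φ x‖ ^ 2 := by
  have hnorm (x) : ‖gradient φ x‖ = ‖fderiv ℝ φ x‖ := LinearIsometryEquiv.norm_map _ _
  have hfderiv (x) (hx : x ∉ tsupport φ) : fderiv ℝ φ x = 0 :=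
    image_eq_zero_of_notMem_tsupport fun h ↦ hx (tsupport_fderiv_subset ℝ h)
  rw [setIntegral_eq_integral_of_forall_compl_eq_zero fun x hx ↦ by
      simp [image_eq_zero_of_notMem_tsupport fun h ↦ hx (hφΩ h)],
    setIntegral_eq_integral_of_forall_compl_eq_zero fun x hx ↦ by
      simp [hnorm, hfderiv x fun h ↦ hx (hφΩ h)]]
  have hsq : tsupport (fun x ↦ φ x ^ 2) ⊆ tsupport φ :=
    closure_mono fun x hx h ↦ hx (by simp [h])
  have hY : ContDiff ℝ 1 fun x ↦ φ x ^ 2 • X x :=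
    contDiff_smul_of_tsupport_subset hΩ (hφ.pow 2) hX (hsq.trans hφΩ)
  have hsqc : HasCompactSupport fun x ↦ φ x ^ 2 := hφc.mono' (subset_closure.trans hsq)
  have hYc : HasCompactSupport fun x ↦ φ x ^ 2 • X x := hsqc.smul_right
  have hφint : Integrable fun x ↦ φ x ^ 2 :=
    (hφ.continuous.pow 2).integrable_of_hasCompactSupport hsqc
  have hgint : Integrable fun x ↦ ‖gradient φ x‖ ^ 2 := by
    simp_rw [hnorm]
    have hcont : Continuous fun x ↦ ‖fderiv ℝ φ x‖ ^ 2 :=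
      (hφ.continuous_fderiv one_ne_zero).norm.pow 2
    exact hcont.integrable_of_hasCompactSupport
      ((hφc.fderiv ℝ).norm.comp_left (g := fun t : ℝ ↦ t ^ 2) (by simp))
  have hpt (x) : c * φ x ^ 2 - ediv (fun x ↦ φ x ^ 2 • X x) x ≤ ‖gradient φ x‖ ^ 2 := by
    by_cases hx : x ∈ tsupport φ
    · have hφx : HasFDerivAt φ (fderiv ℝ φ x) x := (hφ.differentiable one_ne_zero x).hasFDerivAt
      have hXx := (hX.contDiffAt (hΩ.mem_nhds (hφΩ hx))).differentiableAt one_ne_zero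
      rw [ediv_smul (hφx.pow 2).differentiableAt hXx, (hφx.pow 2).fderiv]
      have hn : 0 ≤ ‖gradient φ x + φ x • X x‖ ^ 2 := by positivity
      rw [norm_add_sq_real, inner_smul_right, inner_gradient_left, norm_smul, mul_pow,
        Real.norm_eq_abs, sq_abs] at hn
      have := mul_le_mul_of_nonneg_left (hc x (hφΩ hx)) (sq_nonneg (φ x))
      simp only [smul_apply, smul_eq_mul, nsmul_eq_mul]
      norm_num
      linarith
    · have h0 : (fun x ↦ φ x ^ 2 • X x) =ᶠ[𝓝 x] fun _ ↦ 0 := by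
        filter_upwards [notMem_tsupport_iff_eventuallyEq.1 hx] with y hy
        simp [hy]
      simp [ediv, h0.fderiv_eq, image_eq_zero_of_notMem_tsupport hx]
  have key := integral_mono ((hφint.const_mul c).sub (integrable_ediv hY hYc)) hgint hpt
  rwa [integral_sub' (hφint.const_mul c) (integrable_ediv hY hYc), integral_ediv_eq_zero hY hYc,
    sub_zero, integral_const_mul] at key

/-- Euclidean case of Theorem 2.3: if `X` is a `C¹` vector field on the open
set `Ω ⊆ ℝⁿ` with `div X - ‖X‖² ≥ c` on `Ω`, then `λ*(Ω) ≥ c`; equivalently, for every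
smooth `φ` with compact support in `Ω`, `∫_Ω ‖∇φ‖² ≥ c ∫_Ω φ²`. -/
theorem stmt0 (n : ℕ) (hn : 2 ≤ n) (Ω : Set (EuclideanSpace ℝ (Fin n))) (hΩ : IsOpen Ω)
    (X : EuclideanSpace ℝ (Fin n) → EuclideanSpace ℝ (Fin n)) (hX : ContDiffOn ℝ 1 X Ω)
    (c : ℝ) (hc : ∀ x ∈ Ω, c ≤ ediv X x - ‖X x‖ ^ 2) :
    ENNReal.ofReal c ≤ lamStar n Ω ∧
      ∀ φ : EuclideanSpace ℝ (Fin n) → ℝ, ContDiff ℝ (⊤ : ℕ∞) φ → HasCompactSupport φ →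
        tsupport φ ⊆ Ω →
        c * ∫ x in Ω, φ x ^ 2 ≤ ∫ x in Ω, ‖gradient φ x‖ ^ 2 := by
  have key : ∀ φ : EuclideanSpace ℝ (Fin n) → ℝ, ContDiff ℝ (⊤ : ℕ∞) φ → HasCompactSupport φ →
      tsupport φ ⊆ Ω → c * ∫ x in Ω, φ x ^ 2 ≤ ∫ x in Ω, ‖gradient φ x‖ ^ 2 :=
    fun φ hφ hφc hφΩ ↦ mul_integral_sq_le_integral_norm_gradient_sq hΩ hX hc
      (hφ.of_le (by exact_mod_cast le_top)) hφc hφΩ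
  refine ⟨le_iInf fun ⟨φ, hφ, hφc, hφΩ, hφ0⟩ ↦ ENNReal.ofReal_le_ofReal ?_, key⟩
  obtain ⟨x, hx⟩ := Function.ne_iff.1 hφ0
  have hpos : 0 < ∫ x in Ω, φ x ^ 2 := by
    rw [setIntegral_eq_integral_of_forall_compl_eq_zero fun x hx ↦ by
      simp [image_eq_zero_of_notMem_tsupport fun h ↦ hx (hφΩ h)]]
    exact (hφ.continuous.pow 2).integral_pos_of_hasCompactSupport_nonneg_nonzero
      (hφc.comp_left (g := fun t : ℝ ↦ t ^ 2) (by simp)) (fun x ↦ sq_nonneg (φ x))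
      (x := x) (pow_ne_zero 2 hx)
  exact (le_div_iff₀ hpos).2 (key φ hφ hφc hφΩ)
end

section
/- Let n ≥ 2 be an integer, let 0 < r ≤ ∞, let w : (0, r) → (0, ∞) be a C¹ function, and let X : (0, r) → ℝ be a C¹ function such that X′(t) + (n−1)(w′(t)/w(t))X(t) − X(t)² ≥ c for all t ∈ (0, r), for some constant c ∈ ℝ. Then μ_n(w, r) ≥ c; equivalently, for every smooth φ : ℝ → ℝ with compact support contained in (0, r) one has ∫₀ʳ φ′(t)² w(t)^{n−1} dt ≥ c ∫₀ʳ φ(t)² w(t)^{n−1} dt. -/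
open scoped ENNReal Topology
open MeasureTheory

/-- `Sk κ` is the function `S_κ`: `sinh(√(-κ) t)/√(-κ)` for `κ < 0`, `t` for `κ = 0`,
and `sin(√κ t)/√κ` for `κ > 0`. -/
noncomputable def Sk (κ : ℝ) (t : ℝ) : ℝ :=
  if κ < 0 then Real.sinh (Real.sqrt (-κ) * t) / Real.sqrt (-κ)
  else if κ = 0 then t
  else Real.sin (Real.sqrt κ * t) / Real.sqrt κ

/-- The weighted fundamental tone `μ_n(w, ·)` on the interval `s ⊆ ℝ`: the infimum of
`∫_s φ'(t)² w(t)^(n-1) dt / ∫_s φ(t)² w(t)^(n-1) dt` over all smooth `φ : ℝ → ℝ`, not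
identically zero, with compact support contained in `s`.  Taking `s = Set.Ioo 0 r` gives
`μ_n(w, r)` and `s = Set.Ioi 0` gives `μ_n(w, ∞)`. -/
noncomputable def mu (n : ℕ) (w : ℝ → ℝ) (s : Set ℝ) : ℝ :=
  sInf { q : ℝ | ∃ φ : ℝ → ℝ, ContDiff ℝ (⊤ : ℕ∞) φ ∧ HasCompactSupport φ ∧ tsupport φ ⊆ s ∧
    φ ≠ 0 ∧
    q = (∫ t in s, deriv φ t ^ 2 * w t ^ (n - 1)) / ∫ t in s, φ t ^ 2 * w t ^ (n - 1) }

/-- The interval `(0, r)` for `r ∈ (0, ∞]` (as an extended nonnegative real). -/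
def dom (r : ℝ≥0∞) : Set ℝ := {t : ℝ | 0 < t ∧ ENNReal.ofReal t < r}

theorem isOpen_dom (r : ℝ≥0∞) : IsOpen (dom r) :=
  (isOpen_lt continuous_const continuous_id).inter
    (isOpen_lt ENNReal.continuous_ofReal continuous_const)

theorem dom_nonempty {r : ℝ≥0∞} (hr : 0 < r) : (dom r).Nonempty := by
  obtain ⟨q, -, hqr⟩ := ENNReal.lt_iff_exists_real_btwn.1 hr
  refine ⟨q, ?_, hqr.2⟩
  simpa using hqr.1

section TestFunctions

variable {s : Set ℝ} {φ g : ℝ → ℝ}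

theorem tsupport_mul_subset_of_left (hφs : tsupport φ ⊆ s) :
    tsupport (fun t => φ t * g t) ⊆ s :=
  (tsupport_mul_subset_left (f := φ) (g := g)).trans hφs

theorem continuous_mul_of_tsupport_subset (hs : IsOpen s) (hφ : Continuous φ)
    (hφs : tsupport φ ⊆ s) (hg : ContinuousOn g s) : Continuous fun t => φ t * g t :=
  (hφ.continuousOn.mul hg).continuous_of_tsupport_subset hs (tsupport_mul_subset_of_left hφs)

theorem integrable_mul_of_tsupport_subset (hs : IsOpen s) (hφ : Continuous φ)
    (hφc : HasCompactSupport φ) (hφs : tsupport φ ⊆ s) (hg : ContinuousOn g s) :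
    Integrable fun t => φ t * g t :=
  (continuous_mul_of_tsupport_subset hs hφ hφs hg).integrable_of_hasCompactSupport
    hφc.mul_right

/-- The integral of the derivative of `φ g` vanishes when `φ` is a test function on `s`. -/
theorem integral_deriv_mul_eq_zero (hs : IsOpen s) (hφ : ContDiff ℝ 1 φ)
    (hφc : HasCompactSupport φ) (hφs : tsupport φ ⊆ s) {g' : ℝ → ℝ}
    (hg : ∀ t ∈ s, HasDerivAt g (g' t) t) (hg' : ContinuousOn g' s) :
    Integrable (fun t => deriv φ t * g t + φ t * g' t) ∧
      ∫ t, (deriv φ t * g t + φ t * g' t) = 0 := by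
  have hgc : ContinuousOn g s := fun t ht => (hg t ht).continuousAt.continuousWithinAt
  have hint : Integrable (fun t => deriv φ t * g t + φ t * g' t) :=
    (integrable_mul_of_tsupport_subset hs (hφ.continuous_deriv le_rfl) hφc.deriv
      (tsupport_deriv_subset.trans hφs) hgc).add
      (integrable_mul_of_tsupport_subset hs hφ.continuous hφc hφs hg')
  refine ⟨hint, integral_eq_zero_of_hasDerivAt_of_integrable (f := fun t => φ t * g t) ?_ hint
    (integrable_mul_of_tsupport_subset hs hφ.continuous hφc hφs hgc)⟩
  intro t
  by_cases ht : t ∈ tsupport φ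
  · exact ((hφ.differentiable one_ne_zero) t).hasDerivAt.mul (hg t (hφs ht))
  · have h0 := notMem_tsupport_iff_eventuallyEq.1 ht
    have h1 : (fun t => φ t * g t) =ᶠ[𝓝 t] fun _ => 0 := by
      filter_upwards [h0] with x hx
      simp [hx]
    rw [h0.deriv_eq, h0.eq_of_nhds]
    simpa using (hasDerivAt_const t (0 : ℝ)).congr_of_eventuallyEq h1

theorem tsupport_sq_subset (hφs : tsupport φ ⊆ s) : tsupport (fun t => φ t ^ 2) ⊆ s := by
  simpa only [sq] using tsupport_mul_subset_of_left (g := φ) hφs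

theorem hasCompactSupport_sq (hφc : HasCompactSupport φ) :
    HasCompactSupport fun t => φ t ^ 2 := by
  simp only [sq]
  exact hφc.mul_right (f' := φ)

theorem setIntegral_sq_mul_eq_integral (hφs : tsupport φ ⊆ s) :
    ∫ t in s, φ t ^ 2 * g t = ∫ t, φ t ^ 2 * g t := by
  refine setIntegral_eq_integral_of_forall_compl_eq_zero fun t ht => ?_
  simp [image_eq_zero_of_notMem_tsupport fun h => ht (hφs h)]

theorem setIntegral_sq_mul_pos (hs : IsOpen s) (hφ : Continuous φ) (hφc : HasCompactSupport φ)
    (hφs : tsupport φ ⊆ s) (hφ0 : φ ≠ 0) (hg : ContinuousOn g s) (hgpos : ∀ t ∈ s, 0 < g t) :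
    0 < ∫ t in s, φ t ^ 2 * g t := by
  rw [setIntegral_sq_mul_eq_integral hφs]
  obtain ⟨x, hx⟩ := Function.ne_iff.1 hφ0
  have hxs : x ∈ s := hφs (subset_tsupport φ hx)
  refine (continuous_mul_of_tsupport_subset hs (hφ.pow 2) (tsupport_sq_subset hφs)
    hg).integral_pos_of_hasCompactSupport_nonneg_nonzero
    ((hasCompactSupport_sq hφc).mul_right (f' := g)) (fun t => ?_) (x := x)
    (mul_ne_zero (pow_ne_zero 2 hx) (hgpos x hxs).ne')
  by_cases ht : t ∈ s
  · exact mul_nonneg (sq_nonneg _) (hgpos t ht).le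
  · simp [image_eq_zero_of_notMem_tsupport fun h => ht (hφs h)]

theorem exists_test_function (hs : IsOpen s) (hne : s.Nonempty) :
    ∃ φ : ℝ → ℝ, ContDiff ℝ (⊤ : ℕ∞) φ ∧ HasCompactSupport φ ∧ tsupport φ ⊆ s ∧ φ ≠ 0 := by
  obtain ⟨x, hx⟩ := hne
  obtain ⟨φ, hφs, hφc, hφ, -, hφx⟩ := exists_contDiff_tsupport_subset (n := ⊤) (hs.mem_nhds hx)
  exact ⟨φ, hφ, hφc, hφs, fun h => by simp [h] at hφx⟩

/-- Barta's inequality: `X' + (n-1)(w'/w)X - X² ≥ c` on an open set `s` bounds the weighted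
Dirichlet energy of test functions on `s` from below by `c` times their weighted `L²` norm. -/
theorem mul_setIntegral_sq_le_of_riccati (hs : IsOpen s) {n : ℕ} (hn : 1 ≤ n) {w X : ℝ → ℝ}
    (hw : ContDiffOn ℝ 1 w s) (hwpos : ∀ t ∈ s, 0 < w t) (hX : ContDiffOn ℝ 1 X s) {c : ℝ}
    (hc : ∀ t ∈ s, c ≤ deriv X t + ((n : ℝ) - 1) * (deriv w t / w t) * X t - X t ^ 2)
    (hφ : ContDiff ℝ 1 φ) (hφc : HasCompactSupport φ) (hφs : tsupport φ ⊆ s) :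
    c * ∫ t in s, φ t ^ 2 * w t ^ (n - 1) ≤ ∫ t in s, deriv φ t ^ 2 * w t ^ (n - 1) := by
  have hderiv {f : ℝ → ℝ} (hf : ContDiffOn ℝ 1 f s) (t : ℝ) (ht : t ∈ s) :
      HasDerivAt f (deriv f t) t :=
    ((hf.differentiableOn one_ne_zero).differentiableAt (hs.mem_nhds ht)).hasDerivAt
  have hw' := hw.continuousOn_deriv_of_isOpen hs le_rfl
  have hX' := hX.continuousOn_deriv_of_isOpen hs le_rfl
  have hW : ContinuousOn (fun t => w t ^ (n - 1)) s := hw.continuousOn.pow (n - 1)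
  have hφ's := tsupport_deriv_subset.trans hφs
  obtain ⟨hint, hzero⟩ := integral_deriv_mul_eq_zero hs (hφ.pow 2) (hasCompactSupport_sq hφc)
    (tsupport_sq_subset hφs) (g := fun t => X t * w t ^ (n - 1))
    (fun t ht => (hderiv hX t ht).mul ((hderiv hw t ht).pow (n - 1)))
    ((hX'.mul hW).add (hX.continuousOn.mul
      ((continuousOn_const.mul (hw.continuousOn.pow (n - 1 - 1))).mul hw')))
  have hφint : Integrable fun t => φ t ^ 2 * w t ^ (n - 1) :=
    integrable_mul_of_tsupport_subset hs (hφ.continuous.pow 2)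
    (hasCompactSupport_sq hφc) (tsupport_sq_subset hφs) hW
  have hφ'int : Integrable fun t => deriv φ t ^ 2 * w t ^ (n - 1) :=
    integrable_mul_of_tsupport_subset hs ((hφ.continuous_deriv le_rfl).pow 2)
    (hasCompactSupport_sq hφc.deriv) (tsupport_sq_subset hφ's) hW
  rw [setIntegral_sq_mul_eq_integral hφs, setIntegral_sq_mul_eq_integral hφ's,
    ← integral_const_mul, ← add_zero (∫ t, deriv φ t ^ 2 * w t ^ (n - 1)), ← hzero,
    ← integral_add hφ'int hint]
  refine integral_mono (hφint.const_mul c) (hφ'int.add hint) fun t => ?_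
  have hsq : deriv (fun t => φ t ^ 2) t = 2 * φ t * deriv φ t := by
    simpa using (((hφ.differentiable one_ne_zero) t).hasDerivAt.fun_pow 2).deriv
  by_cases ht : t ∈ s
  · have hwt := hwpos t ht
    have hpow : ((n - 1 : ℕ) : ℝ) * w t ^ (n - 1 - 1) * deriv w t
        = ((n : ℝ) - 1) * (deriv w t / w t) * w t ^ (n - 1) := by
      obtain ⟨m, rfl⟩ := Nat.exists_eq_add_of_le' hn
      cases m with
      | zero => simp
      | succ k =>
        simp only [Nat.add_sub_cancel, pow_succ]
        push_cast
        field_simp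
        ring
    have h1 := mul_le_mul_of_nonneg_left (hc t ht)
      (mul_nonneg (sq_nonneg (φ t)) (pow_pos hwt (n - 1)).le)
    have h2 := mul_nonneg (sq_nonneg (deriv φ t + φ t * X t)) (pow_pos hwt (n - 1)).le
    simp only [hsq, hpow]
    linarith
  · have h0 : t ∉ tsupport φ := fun h => ht (hφs h)
    have h1 := notMem_tsupport_iff_eventuallyEq.1 h0
    simp [image_eq_zero_of_notMem_tsupport h0, h1.deriv_eq, hsq]

end TestFunctions

/-- radial form of Theorem 2.3: if `w : (0,r) → (0,∞)` is `C¹` and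
`X : (0,r) → ℝ` is `C¹` with `X' + (n-1)(w'/w)X - X² ≥ c` on `(0,r)`, then
`μ_n(w, r) ≥ c`; equivalently, for every smooth `φ` with compact support in `(0,r)`,
`∫₀ʳ φ'² w^{n-1} ≥ c ∫₀ʳ φ² w^{n-1}`. -/
theorem stmt4 (n : ℕ) (hn : 2 ≤ n) (r : ℝ≥0∞) (hr : 0 < r)
    (w : ℝ → ℝ) (hw : ContDiffOn ℝ 1 w (dom r)) (hwpos : ∀ t ∈ dom r, 0 < w t)
    (X : ℝ → ℝ) (hX : ContDiffOn ℝ 1 X (dom r))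
    (c : ℝ)
    (hc : ∀ t ∈ dom r, c ≤ deriv X t + ((n : ℝ) - 1) * (deriv w t / w t) * X t - X t ^ 2) :
    c ≤ mu n w (dom r) ∧
      ∀ φ : ℝ → ℝ, ContDiff ℝ (⊤ : ℕ∞) φ → HasCompactSupport φ → tsupport φ ⊆ dom r →
        c * ∫ t in dom r, φ t ^ 2 * w t ^ (n - 1) ≤
          ∫ t in dom r, deriv φ t ^ 2 * w t ^ (n - 1) := by
  have hs := isOpen_dom r
  have key (φ : ℝ → ℝ) (hφ : ContDiff ℝ (⊤ : ℕ∞) φ) (hφc : HasCompactSupport φ)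
      (hφs : tsupport φ ⊆ dom r) :
      c * ∫ t in dom r, φ t ^ 2 * w t ^ (n - 1) ≤
        ∫ t in dom r, deriv φ t ^ 2 * w t ^ (n - 1) :=
    mul_setIntegral_sq_le_of_riccati hs (by lia) hw hwpos hX hc
      (hφ.of_le (by exact_mod_cast le_top)) hφc hφs
  refine ⟨le_csInf ?_ ?_, key⟩
  · obtain ⟨φ, hφ, hφc, hφs, hφ0⟩ := exists_test_function hs (dom_nonempty hr)
    exact ⟨_, φ, hφ, hφc, hφs, hφ0, rfl⟩
  · rintro q ⟨φ, hφ, hφc, hφs, hφ0, rfl⟩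
    rw [le_div_iff₀ (setIntegral_sq_mul_pos hs hφ.continuous hφc hφs hφ0
      (g := fun t => w t ^ (n - 1)) (hw.continuousOn.pow (n - 1)) fun t ht => pow_pos (hwpos t ht) _)]
    exact key φ hφ hφc hφs
end

section
/- Let n ≥ 2 be an integer, let κ ∈ ℝ, and let 0 < r < ∞, with r < π/√κ when κ > 0. Let f : [0, r] → ℝ be smooth with f(0) = 0, f′(0) = 1, and f(t) > 0 for all t ∈ (0, r]. If f′(t)/f(t) ≥ S_κ′(t)/S_κ(t) for all t ∈ (0, r), then μ_n(f, r) ≥ μ_n(S_κ, r). If instead f′(t)/f(t) ≤ S_κ′(t)/S_κ(t) for all t ∈ (0, r), then μ_n(f, r) ≤ μ_n(S_κ, r). -/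
open scoped ENNReal Topology
open MeasureTheory

open Set Filter in
/-- Logarithmic cutoffs: near `0` the weight `t dt` has zero capacity. -/
lemma exists_log_cutoff {s ε : ℝ} (hs : 0 < s) (hε : 0 < ε) :
    ∃ (η : ℝ → ℝ) (a : ℝ), 0 < a ∧ ContDiff ℝ (⊤ : ℕ∞) η ∧ (∀ t ≤ a, η t = 0) ∧
      (∀ t, s ≤ t → η t = 1) ∧ ∫ t in (0 : ℝ)..s, deriv η t ^ 2 * t ≤ ε := by
  have hT : ContDiff ℝ (⊤ : ℕ∞) Real.smoothTransition := Real.smoothTransition.contDiff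
  have hT' : Continuous (deriv Real.smoothTransition) := hT.continuous_deriv (by simp)
  obtain ⟨M, hM⟩ := isCompact_Icc.exists_bound_of_continuousOn (s := Icc (0 : ℝ) 1)
    hT'.continuousOn
  obtain ⟨k, hk1, hk2, hk3⟩ : ∃ k : ℝ, 0 < k ∧ -Real.log s ≤ k ∧ M ^ 2 / ε ≤ k :=
    ⟨max 1 (max (-Real.log s) (M ^ 2 / ε)), by positivity, by simp, by simp⟩
  set η : ℝ → ℝ := fun t => if t ≤ 0 then 0 else Real.smoothTransition (2 + Real.log t / k)
    with hη
  set a := Real.exp (-(2 * k)) with ha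
  set b := Real.exp (-k) with hb
  have ha0 : 0 < a := Real.exp_pos _
  have hb0 : 0 < b := Real.exp_pos _
  have hab : a < b := Real.exp_lt_exp.2 (by linarith)
  have hbs : b ≤ s := by
    rw [← Real.exp_log hs]
    exact Real.exp_le_exp.2 (by linarith)
  have h0 : ∀ t ≤ a, η t = 0 := by
    intro t ht
    by_cases h : t ≤ 0
    · simp [hη, h]
    · simp only [hη, h, if_false]
      push Not at h
      apply Real.smoothTransition.zero_of_nonpos
      have h1 : Real.log t ≤ -(2 * k) := (Real.log_le_iff_le_exp h).2 ht
      have h2 : Real.log t / k ≤ -2 := by rw [div_le_iff₀ hk1]; linarith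
      linarith
  have h1 : ∀ t, b ≤ t → η t = 1 := by
    intro t ht
    have h : ¬ t ≤ 0 := by linarith
    simp only [hη, h, if_false]
    apply Real.smoothTransition.one_of_one_le
    have h1 : -k ≤ Real.log t := (Real.le_log_iff_exp_le (by linarith)).2 ht
    have h2 : -1 ≤ Real.log t / k := by rw [le_div_iff₀ hk1]; linarith
    linarith
  have heq : ∀ t, 0 < t → η =ᶠ[𝓝 t] fun t => Real.smoothTransition (2 + Real.log t / k) := by
    intro t ht
    filter_upwards [lt_mem_nhds ht] with x hx
    simp [hη, not_le.2 hx]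
  have hηs : ContDiff ℝ (⊤ : ℕ∞) η := by
    rw [contDiff_iff_contDiffAt]
    intro t
    by_cases ht : t < a
    · refine (contDiffAt_const (c := (0 : ℝ))).congr_of_eventuallyEq ?_
      filter_upwards [gt_mem_nhds ht] with x hx using h0 x hx.le
    · have ht0 : 0 < t := by linarith
      refine ContDiffAt.congr_of_eventuallyEq ?_ (heq t ht0)
      exact hT.contDiffAt.comp t
        (contDiffAt_const.add ((Real.contDiffAt_log.2 ht0.ne').div_const k))
  have hη' : Continuous (deriv η) := hηs.continuous_deriv (by simp)
  have hd : ∀ t, 0 < t →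
      deriv η t = deriv Real.smoothTransition (2 + Real.log t / k) * (t⁻¹ / k) := by
    intro t ht
    rw [(heq t ht).deriv_eq]
    have h2 : HasDerivAt (fun t => 2 + Real.log t / k) (t⁻¹ / k) t :=
      ((Real.hasDerivAt_log ht.ne').div_const k).const_add 2
    exact (((hT.differentiable (by simp)) _).hasDerivAt.comp t h2).deriv
  have hii : ∀ x y : ℝ, IntervalIntegrable (fun t => deriv η t ^ 2 * t) volume x y :=
    fun x y => ((hη'.pow 2).mul continuous_id).intervalIntegrable x y
  refine ⟨η, a, ha0, hηs, h0, fun t ht => h1 t (hbs.trans ht), ?_⟩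
  have I1 : ∫ t in (0 : ℝ)..a, deriv η t ^ 2 * t ≤ ∫ t in (0 : ℝ)..a, (0 : ℝ) := by
    refine intervalIntegral.integral_mono_on_of_le_Ioo ha0.le (hii _ _) (by simp) ?_
    intro x hx
    have : η =ᶠ[𝓝 x] fun _ => (0 : ℝ) := by
      filter_upwards [gt_mem_nhds hx.2] with y hy using h0 y hy.le
    simp [this.deriv_eq]
  have I3 : ∫ t in b..s, deriv η t ^ 2 * t ≤ ∫ t in b..s, (0 : ℝ) := by
    refine intervalIntegral.integral_mono_on_of_le_Ioo hbs (hii _ _) (by simp) ?_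
    intro x hx
    have : η =ᶠ[𝓝 x] fun _ => (1 : ℝ) := by
      filter_upwards [lt_mem_nhds hx.1] with y hy using h1 y hy.le
    simp [this.deriv_eq]
  have hinv : IntervalIntegrable (fun t : ℝ => M ^ 2 / k ^ 2 * t⁻¹) volume a b := by
    refine ContinuousOn.intervalIntegrable ?_
    rw [uIcc_of_le hab.le]
    exact continuousOn_const.mul (continuousOn_id.inv₀ fun x hx => (ha0.trans_le hx.1).ne')
  have I2 : ∫ t in a..b, deriv η t ^ 2 * t ≤ ∫ t in a..b, M ^ 2 / k ^ 2 * t⁻¹ := by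
    refine intervalIntegral.integral_mono_on_of_le_Ioo hab.le (hii _ _) hinv ?_
    intro x hx
    have hx0 : 0 < x := ha0.trans hx.1
    have hl1 : -(2 * k) ≤ Real.log x := (Real.le_log_iff_exp_le hx0).2 hx.1.le
    have hl2 : Real.log x ≤ -k := (Real.log_le_iff_le_exp hx0).2 hx.2.le
    have e1 : -2 ≤ Real.log x / k := by rw [le_div_iff₀ hk1]; linarith
    have e2 : Real.log x / k ≤ -1 := by rw [div_le_iff₀ hk1]; linarith
    have hb := hM (2 + Real.log x / k) ⟨by linarith, by linarith⟩
    rw [Real.norm_eq_abs] at hb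
    have hsq : deriv Real.smoothTransition (2 + Real.log x / k) ^ 2 ≤ M ^ 2 := by
      rw [← sq_abs]
      exact pow_le_pow_left₀ (abs_nonneg _) hb 2
    rw [hd x hx0]
    calc (deriv Real.smoothTransition (2 + Real.log x / k) * (x⁻¹ / k)) ^ 2 * x
        = deriv Real.smoothTransition (2 + Real.log x / k) ^ 2 * (x⁻¹ / k ^ 2) := by
          field_simp
      _ ≤ M ^ 2 * (x⁻¹ / k ^ 2) := by gcongr
      _ = M ^ 2 / k ^ 2 * x⁻¹ := by ring
  have I2' : ∫ t in a..b, M ^ 2 / k ^ 2 * t⁻¹ = M ^ 2 / k := by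
    rw [intervalIntegral.integral_const_mul, integral_inv_of_pos ha0 hb0, ha, hb,
      ← Real.exp_sub, Real.log_exp]
    field_simp
    ring
  have hfin : M ^ 2 / k ≤ ε := by
    rw [div_le_iff₀ hk1]
    rwa [div_le_iff₀ hε, mul_comm] at hk3
  rw [← intervalIntegral.integral_add_adjacent_intervals (hii 0 b) (hii b s),
    ← intervalIntegral.integral_add_adjacent_intervals (hii 0 a) (hii a b)]
  simp only [intervalIntegral.integral_zero] at I1 I3
  linarith

/-- The smooth functions with compact support contained in `s`. -/
def IsTestFunction (s : Set ℝ) (φ : ℝ → ℝ) : Prop :=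
  ContDiff ℝ (⊤ : ℕ∞) φ ∧ HasCompactSupport φ ∧ tsupport φ ⊆ s

open Set in
lemma IsTestFunction.exists_tsupport_subset_Ioo {r : ℝ} (hr : 0 < r) {φ : ℝ → ℝ}
    (hφ : IsTestFunction (Ioo 0 r) φ) :
    ∃ a b, 0 < a ∧ a < b ∧ b < r ∧ tsupport φ ⊆ Ioo a b := by
  obtain ⟨-, hc, hs⟩ := hφ
  rcases (tsupport φ).eq_empty_or_nonempty with he | hne
  · exact ⟨r / 3, r / 2, by linarith, by linarith, by linarith, by simp [he]⟩
  · obtain ⟨x, hx⟩ := hc.isCompact.exists_isLeast hne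
    obtain ⟨y, hy⟩ := hc.isCompact.exists_isGreatest hne
    have hx' := hs hx.1
    have hy' := hs hy.1
    have hxy := hx.2 hy.1
    refine ⟨x / 2, (y + r) / 2, by linarith [hx'.1], by linarith [hx'.1, hy'.2],
      by linarith [hy'.2], fun z hz => ⟨?_, ?_⟩⟩
    · linarith [hx.2 hz, hx'.1]
    · linarith [hy.2 hz, hy'.2]

open Set in
lemma isTestFunction_of_eq_zero {r a b : ℝ} (ha : 0 < a) (hb : b < r) {φ : ℝ → ℝ}
    (hφ : ContDiff ℝ (⊤ : ℕ∞) φ) (h0 : ∀ t ≤ a, φ t = 0) (h1 : ∀ t, b ≤ t → φ t = 0) :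
    IsTestFunction (Ioo 0 r) φ := by
  have hsub : tsupport φ ⊆ Icc a b := by
    refine closure_minimal (fun t ht => ?_) isClosed_Icc
    constructor
    · by_contra! h
      exact ht (h0 t h.le)
    · by_contra! h
      exact ht (h1 t h.le)
  exact ⟨hφ, isCompact_Icc.of_isClosed_subset (isClosed_tsupport φ) hsub,
    hsub.trans fun t ht => ⟨ha.trans_le ht.1, ht.2.trans_lt hb⟩⟩

open Set Filter in
/-- Given a test function `φ` and `0 < s < s' < r`, there is a test function which agrees with `φ`
on `[s', r]` and whose energy is at most that of `φ` on `[s, r]` up to an error `ε`. -/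
lemma exists_test_truncation {r C s s' ε : ℝ} {w φ : ℝ → ℝ} (hr : 0 < r) (hC : 0 ≤ C)
    (hw : ContinuousOn w (Icc 0 r)) (hw0 : ∀ t ∈ Icc 0 r, 0 ≤ w t)
    (hwC : ∀ t ∈ Icc 0 r, w t ≤ C * t) (hφ : IsTestFunction (Ioo 0 r) φ)
    (hs : 0 < s) (hss' : s < s') (hs'r : s' < r) (hε : 0 < ε) :
    ∃ v, IsTestFunction (Ioo 0 r) v ∧ (∀ t ∈ Icc s' r, v t = φ t) ∧
      ∫ t in (0 : ℝ)..r, deriv v t ^ 2 * w t ≤ (∫ t in s..r, deriv φ t ^ 2 * w t) + ε := by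
  obtain ⟨a₀, b₀, -, -, hb₀r, hab₀⟩ := hφ.exists_tsupport_subset_Ioo hr
  have hφb : ∀ t, b₀ ≤ t → φ t = 0 := fun t ht =>
    image_eq_zero_of_notMem_tsupport fun h => (hab₀ h).2.not_ge ht
  have hφs := hφ.1
  have hφ' : ContDiff ℝ (⊤ : ℕ∞) (deriv φ) := (contDiff_infty_iff_deriv.1 hφs).2
  set χ : ℝ → ℝ := fun x => Real.smoothTransition ((x - s) / (s' - s)) with hχdef
  have hχ : ContDiff ℝ (⊤ : ℕ∞) χ :=
    Real.smoothTransition.contDiff.comp ((contDiff_id.sub contDiff_const).div_const _)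
  have hχ0 : ∀ x ≤ s, χ x = 0 := fun x hx => Real.smoothTransition.zero_of_nonpos
    (div_nonpos_of_nonpos_of_nonneg (by linarith) (by linarith))
  have hχ1 : ∀ x, s' ≤ x → χ x = 1 := fun x hx => Real.smoothTransition.one_of_one_le
    ((one_le_div (by linarith)).2 (by linarith))
  have hχsq : ∀ x, χ x ^ 2 ≤ 1 := fun x =>
    pow_le_one₀ (Real.smoothTransition.nonneg _) (Real.smoothTransition.le_one _)
  have hg : ContDiff ℝ (⊤ : ℕ∞) (fun x => deriv φ x * χ x) := hφ'.mul hχ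
  set u : ℝ → ℝ := fun t => ∫ x in r..t, deriv φ x * χ x with hudef
  have hud : ∀ t, HasDerivAt u (deriv φ t * χ t) t := fun t =>
    (hg.continuous.integral_hasStrictDerivAt r t).hasDerivAt
  have hu : ContDiff ℝ (⊤ : ℕ∞) u := by
    refine contDiff_infty_iff_deriv.2 ⟨fun t => (hud t).differentiableAt, ?_⟩
    rwa [show deriv u = fun x => deriv φ x * χ x from funext fun t => (hud t).deriv]
  have huφ : ∀ t, s' ≤ t → u t = φ t := by
    intro t ht
    have h1 : u t = ∫ x in r..t, deriv φ x := by
      refine intervalIntegral.integral_congr fun x hx => ?_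
      have : s' ≤ x := (le_min hs'r.le ht).trans hx.1
      simp [hχ1 x this]
    rw [h1, intervalIntegral.integral_deriv_eq_sub
      (fun x _ => (hφs.differentiable (by simp)) x)
      (hφ'.continuous.intervalIntegrable _ _), hφb r hb₀r.le, sub_zero]
  have hus : ∀ t ≤ s, u t = u s := by
    intro t ht
    have h1 : ∫ x in s..t, deriv φ x * χ x = 0 := by
      refine (intervalIntegral.integral_congr (g := fun _ => (0 : ℝ)) fun x hx => ?_).trans
        (by simp)
      have : x ≤ s := hx.2.trans (by simp [ht])
      simp [hχ0 x this]
    have h2 := intervalIntegral.integral_add_adjacent_intervals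
      (hg.continuous.intervalIntegrable (μ := volume) r s)
      (hg.continuous.intervalIntegrable (μ := volume) s t)
    simp only [hudef]
    linarith
  set K := u s ^ 2 * C with hK
  have hK0 : 0 ≤ K := by positivity
  obtain ⟨η, a, ha, hη, hη0, hη1, hηε⟩ := exists_log_cutoff hs
    (show 0 < ε / (K + 1) by positivity)
  have hη' : Continuous (deriv η) := hη.continuous_deriv (by simp)
  have hηd : ∀ t, HasDerivAt η (deriv η t) t := fun t =>
    ((hη.differentiable (by simp)) t).hasDerivAt
  set v : ℝ → ℝ := fun t => u t * η t with hvdef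
  have hv : ContDiff ℝ (⊤ : ℕ∞) v := hu.mul hη
  have hvd : ∀ t, deriv v t = deriv φ t * χ t * η t + u t * deriv η t := fun t =>
    ((hud t).mul (hηd t)).deriv
  have hvφ : ∀ t, s' ≤ t → v t = φ t := fun t ht => by
    simp [hvdef, hη1 t (hss'.le.trans ht), huφ t ht]
  have hv' : Continuous (deriv v) := hv.continuous_deriv (by simp)
  refine ⟨v, ?_, fun t ht => hvφ t ht.1, ?_⟩
  · refine isTestFunction_of_eq_zero ha (max_lt hs'r hb₀r) hv
      (fun t ht => by simp [hvdef, hη0 t ht]) fun t ht => ?_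
    rw [hvφ t ((le_max_left _ _).trans ht), hφb t ((le_max_right _ _).trans ht)]
  · have hsr : s < r := hss'.trans hs'r
    have hii : ∀ {g : ℝ → ℝ}, Continuous g → ∀ {x y : ℝ}, 0 ≤ x → x ≤ y → y ≤ r →
        IntervalIntegrable (fun t => g t ^ 2 * w t) volume x y := by
      intro g hg x y hx hxy hy
      refine ContinuousOn.intervalIntegrable ?_
      rw [uIcc_of_le hxy]
      exact (hg.pow 2).continuousOn.mul (hw.mono (Icc_subset_Icc hx hy))
    rw [← intervalIntegral.integral_add_adjacent_intervals (hii hv' le_rfl hs.le hsr.le)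
      (hii hv' hs.le hsr.le le_rfl)]
    have I1 : ∫ t in (0 : ℝ)..s, deriv v t ^ 2 * w t ≤
        ∫ t in (0 : ℝ)..s, K * (deriv η t ^ 2 * t) := by
      refine intervalIntegral.integral_mono_on hs.le (hii hv' le_rfl hs.le hsr.le)
        ((continuous_const.mul ((hη'.pow 2).mul continuous_id)).intervalIntegrable _ _) ?_
      intro t ht
      rw [hvd, hχ0 t ht.2, hus t ht.2]
      have := hwC t ⟨ht.1, ht.2.trans hsr.le⟩
      calc (deriv φ t * 0 * η t + u s * deriv η t) ^ 2 * w t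
          = (u s * deriv η t) ^ 2 * w t := by ring
        _ ≤ (u s * deriv η t) ^ 2 * (C * t) := by gcongr
        _ = K * (deriv η t ^ 2 * t) := by rw [hK]; ring
    have I2 : ∫ t in s..r, deriv v t ^ 2 * w t ≤ ∫ t in s..r, deriv φ t ^ 2 * w t := by
      refine intervalIntegral.integral_mono_on_of_le_Ioo hsr.le (hii hv' hs.le hsr.le le_rfl)
        (hii hφ'.continuous hs.le hsr.le le_rfl) ?_
      intro t ht
      have hd0 : deriv η t = 0 := by
        have : η =ᶠ[𝓝 t] fun _ => (1 : ℝ) := by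
          filter_upwards [lt_mem_nhds ht.1] with y hy using hη1 y hy.le
        simp [this.deriv_eq]
      rw [hvd, hd0, hη1 t ht.1.le]
      have := hw0 t ⟨hs.le.trans ht.1.le, ht.2.le⟩
      refine mul_le_mul_of_nonneg_right ?_ this
      calc (deriv φ t * χ t * 1 + u t * 0) ^ 2 = deriv φ t ^ 2 * χ t ^ 2 := by ring
        _ ≤ deriv φ t ^ 2 * 1 := by gcongr; exact hχsq t
        _ = _ := mul_one _
    rw [intervalIntegral.integral_const_mul] at I1
    have I3 : K * (∫ t in (0 : ℝ)..s, deriv η t ^ 2 * t) ≤ ε := by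
      calc K * (∫ t in (0 : ℝ)..s, deriv η t ^ 2 * t) ≤ K * (ε / (K + 1)) := by gcongr
        _ = ε * (K / (K + 1)) := by ring
        _ ≤ ε * 1 := by
          gcongr
          exact (div_le_one (by positivity)).2 (by linarith)
        _ = ε := mul_one _
    linarith

open Set Filter in
/-- A Poincaré inequality on `(0, r)` restricts to the intervals `(s, r)`, without any boundary
condition at `s`. -/
lemma poincare_restrict {r C l s : ℝ} {w φ : ℝ → ℝ} (hr : 0 < r) (hC : 0 ≤ C)
    (hw : ContinuousOn w (Icc 0 r)) (hw0 : ∀ t ∈ Icc 0 r, 0 ≤ w t)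
    (hwC : ∀ t ∈ Icc 0 r, w t ≤ C * t) (hl : 0 ≤ l)
    (hP : ∀ v, IsTestFunction (Ioo 0 r) v →
      l * ∫ t in (0 : ℝ)..r, v t ^ 2 * w t ≤ ∫ t in (0 : ℝ)..r, deriv v t ^ 2 * w t)
    (hφ : IsTestFunction (Ioo 0 r) φ) (hs : 0 < s) (hsr : s < r) :
    l * ∫ t in s..r, φ t ^ 2 * w t ≤ ∫ t in s..r, deriv φ t ^ 2 * w t := by
  have hii : ∀ {g : ℝ → ℝ}, Continuous g → ∀ {x y : ℝ}, 0 ≤ x → x ≤ y → y ≤ r →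
      IntervalIntegrable (fun t => g t ^ 2 * w t) volume x y := by
    intro g hg x y hx hxy hy
    refine ContinuousOn.intervalIntegrable ?_
    rw [uIcc_of_le hxy]
    exact (hg.pow 2).continuousOn.mul (hw.mono (Icc_subset_Icc hx hy))
  have key : ∀ s' ∈ Ioo s r,
      l * ∫ t in s'..r, φ t ^ 2 * w t ≤ ∫ t in s..r, deriv φ t ^ 2 * w t := by
    intro s' hs'
    have hs'0 : 0 < s' := hs.trans hs'.1
    refine le_of_forall_pos_le_add fun ε hε => ?_
    obtain ⟨v, hv, hvφ, hvε⟩ := exists_test_truncation hr hC hw hw0 hwC hφ hs hs'.1 hs'.2 hε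
    have hvc : Continuous v := hv.1.continuous
    have h1 : ∫ t in s'..r, φ t ^ 2 * w t = ∫ t in s'..r, v t ^ 2 * w t := by
      refine intervalIntegral.integral_congr fun t ht => ?_
      rw [uIcc_of_le hs'.2.le] at ht
      simp only [hvφ t ht]
    have h2 : 0 ≤ ∫ t in (0 : ℝ)..s', v t ^ 2 * w t :=
      intervalIntegral.integral_nonneg hs'0.le fun t ht =>
        mul_nonneg (sq_nonneg _) (hw0 t ⟨ht.1, ht.2.trans hs'.2.le⟩)
    have h3 := intervalIntegral.integral_add_adjacent_intervals
      (hii hvc le_rfl hs'0.le hs'.2.le) (hii hvc hs'0.le hs'.2.le le_rfl)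
    calc l * ∫ t in s'..r, φ t ^ 2 * w t ≤ l * ∫ t in (0 : ℝ)..r, v t ^ 2 * w t := by
          gcongr
          linarith
      _ ≤ _ := hP v hv
      _ ≤ _ := hvε
  have hcont : ContinuousOn (fun x => ∫ t in x..r, φ t ^ 2 * w t) (uIcc s r) := by
    refine intervalIntegral.continuousOn_primitive_interval_left ?_
    rw [uIcc_of_le hsr.le]
    exact ((hφ.1.continuous.pow 2).continuousOn.mul
      (hw.mono (Icc_subset_Icc hs.le le_rfl))).integrableOn_Icc
  rw [uIcc_of_le hsr.le] at hcont
  have ht : Tendsto (fun x => l * ∫ t in x..r, φ t ^ 2 * w t) (𝓝[Ioo s r] s)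
      (𝓝 (l * ∫ t in s..r, φ t ^ 2 * w t)) :=
    (((hcont s (left_mem_Icc.2 hsr.le)).mono Ioo_subset_Icc_self).tendsto).const_mul l
  have : (𝓝[Ioo s r] s).NeBot := by
    rw [nhdsWithin_Ioo_eq_nhdsGT hsr]; infer_instance
  exact le_of_tendsto ht (eventually_nhdsWithin_of_forall key)

open Set Filter in
/-- A Poincaré inequality on `(0, r)` persists when the weight is multiplied by a nondecreasing
function. -/
lemma poincare_mul_monotone {r C l : ℝ} {w h h' φ : ℝ → ℝ} (hr : 0 < r) (hC : 0 ≤ C)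
    (hw : ContinuousOn w (Icc 0 r)) (hw0 : ∀ t ∈ Icc 0 r, 0 ≤ w t)
    (hwC : ∀ t ∈ Icc 0 r, w t ≤ C * t) (hl : 0 ≤ l)
    (hP : ∀ v, IsTestFunction (Ioo 0 r) v →
      l * ∫ t in (0 : ℝ)..r, v t ^ 2 * w t ≤ ∫ t in (0 : ℝ)..r, deriv v t ^ 2 * w t)
    (hh : ∀ t ∈ Ioo 0 r, HasDerivAt h (h' t) t) (hh' : ContinuousOn h' (Ioo 0 r))
    (hh0 : ∀ t ∈ Ioo 0 r, 0 ≤ h t) (hh'0 : ∀ t ∈ Ioo 0 r, 0 ≤ h' t)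
    (hφ : IsTestFunction (Ioo 0 r) φ) :
    l * ∫ t in (0 : ℝ)..r, φ t ^ 2 * (h t * w t) ≤
      ∫ t in (0 : ℝ)..r, deriv φ t ^ 2 * (h t * w t) := by
  obtain ⟨a, b, ha, hab, hb, hsub⟩ := hφ.exists_tsupport_subset_Ioo hr
  have hφc : Continuous φ := hφ.1.continuous
  have hφ'c : Continuous (deriv φ) := hφ.1.continuous_deriv (by simp)
  have hφ0 : ∀ t, t ∉ Ioo a b → φ t = 0 := fun t ht =>
    image_eq_zero_of_notMem_tsupport fun h => ht (hsub h)
  have hφ'0 : ∀ t, t ∉ Ioo a b → deriv φ t = 0 := fun t ht => by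
    by_contra hne
    exact ht (hsub (support_deriv_subset hne))
  have hIcc : Icc a b ⊆ Ioo 0 r := fun t ht => ⟨ha.trans_le ht.1, ht.2.trans_lt hb⟩
  have hrestrict : ∀ g : ℝ → ℝ, (∀ t, t ∉ Ioo a b → g t = 0) →
      ∫ t in (0 : ℝ)..r, g t ^ 2 * (h t * w t) = ∫ t in a..b, g t ^ 2 * (h t * w t) := by
    intro g hg
    have hs : Function.support (fun t => g t ^ 2 * (h t * w t)) ⊆ Ioo a b := by
      intro t ht
      by_contra hne
      exact ht (by simp [hg t hne])
    rw [intervalIntegral.integral_eq_integral_of_support_subset (hs.trans Ioo_subset_Ioc_self),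
      intervalIntegral.integral_eq_integral_of_support_subset]
    exact hs.trans fun t ht => ⟨ha.trans ht.1, ht.2.le.trans hb.le⟩
  rw [hrestrict φ hφ0, hrestrict _ hφ'0]
  set k : ℝ → ℝ := fun t => (deriv φ t ^ 2 - l * φ t ^ 2) * w t with hk
  have hkc : ContinuousOn k (Icc 0 r) :=
    ((hφ'c.pow 2).sub (continuous_const.mul (hφc.pow 2))).continuousOn.mul hw
  set F : ℝ → ℝ := fun t => ∫ x in t..r, k x with hF
  have hFd : ∀ t ∈ Ioo 0 r, HasDerivAt F (-k t) t := by
    intro t ht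
    refine intervalIntegral.integral_hasDerivAt_left ?_ ?_ ?_
    · refine ContinuousOn.intervalIntegrable ?_
      rw [uIcc_of_le ht.2.le]
      exact hkc.mono (Icc_subset_Icc ht.1.le le_rfl)
    · exact (hkc.mono Ioo_subset_Icc_self).stronglyMeasurableAtFilter isOpen_Ioo t ht
    · exact hkc.continuousAt (Icc_mem_nhds ht.1 ht.2)
  have hF0 : ∀ t ∈ Ioo 0 r, 0 ≤ F t := by
    intro t ht
    have h1 := poincare_restrict hr hC hw hw0 hwC hl hP hφ ht.1 ht.2
    have hii : ∀ {g : ℝ → ℝ}, Continuous g →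
        IntervalIntegrable (fun x => g x ^ 2 * w x) volume t r := by
      intro g hg
      refine ContinuousOn.intervalIntegrable ?_
      rw [uIcc_of_le ht.2.le]
      exact (hg.pow 2).continuousOn.mul (hw.mono (Icc_subset_Icc ht.1.le le_rfl))
    have h2 : F t = (∫ x in t..r, deriv φ x ^ 2 * w x) - l * ∫ x in t..r, φ x ^ 2 * w x := by
      rw [← intervalIntegral.integral_const_mul,
        ← intervalIntegral.integral_sub (hii hφ'c) ((hii hφc).const_mul l)]
      refine intervalIntegral.integral_congr fun x _ => ?_
      simp only [hk]
      ring
    linarith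
  have hFb : F b = 0 := by
    refine (intervalIntegral.integral_congr (g := fun _ => (0 : ℝ)) fun x hx => ?_).trans
      (by simp)
    rw [uIcc_of_le hb.le] at hx
    have hx' : x ∉ Ioo a b := fun h => h.2.not_ge hx.1
    simp [hk, hφ0 x hx', hφ'0 x hx']
  have hhc : ContinuousOn h (Icc a b) := fun t ht =>
    (hh t (hIcc ht)).continuousAt.continuousWithinAt
  have hFc : ContinuousOn F (Icc a b) := fun t ht =>
    (hFd t (hIcc ht)).continuousAt.continuousWithinAt
  have hib : ∫ t in a..b, h t * -k t =
      h b * F b - h a * F a - ∫ t in a..b, h' t * F t := by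
    refine intervalIntegral.integral_mul_deriv_eq_deriv_mul (fun t ht => hh t ?_)
      (fun t ht => hFd t ?_) ?_ ?_
    · rw [uIcc_of_le hab.le] at ht
      exact hIcc ht
    · rw [uIcc_of_le hab.le] at ht
      exact hIcc ht
    · refine ContinuousOn.intervalIntegrable ?_
      rw [uIcc_of_le hab.le]
      exact hh'.mono hIcc
    · refine ContinuousOn.intervalIntegrable ?_
      rw [uIcc_of_le hab.le]
      exact (hkc.mono (hIcc.trans Ioo_subset_Icc_self)).neg
  have h1 : 0 ≤ ∫ t in a..b, h' t * F t := intervalIntegral.integral_nonneg hab.le fun t ht =>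
    mul_nonneg (hh'0 t (hIcc ht)) (hF0 t (hIcc ht))
  have haI := hIcc (left_mem_Icc.2 hab.le)
  have h2 : 0 ≤ h a * F a := mul_nonneg (hh0 a haI) (hF0 a haI)
  have hii : ∀ {g : ℝ → ℝ}, Continuous g →
      IntervalIntegrable (fun x => g x ^ 2 * (h x * w x)) volume a b := by
    intro g hg
    refine ContinuousOn.intervalIntegrable ?_
    rw [uIcc_of_le hab.le]
    exact (hg.pow 2).continuousOn.mul (hhc.mul (hw.mono (hIcc.trans Ioo_subset_Icc_self)))
  have h3 : ∫ t in a..b, h t * -k t = l * (∫ t in a..b, φ t ^ 2 * (h t * w t)) -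
      ∫ t in a..b, deriv φ t ^ 2 * (h t * w t) := by
    rw [← intervalIntegral.integral_const_mul,
      ← intervalIntegral.integral_sub ((hii hφc).const_mul l) (hii hφ'c)]
    refine intervalIntegral.integral_congr fun x _ => ?_
    simp only [hk]
    ring
  rw [hFb] at hib
  linarith

open Set in
lemma setIntegral_Ioo_eq_intervalIntegral {r : ℝ} (hr : 0 < r) (g : ℝ → ℝ) :
    ∫ t in Ioo 0 r, g t = ∫ t in (0 : ℝ)..r, g t := by
  rw [intervalIntegral.integral_of_le hr.le, integral_Ioc_eq_integral_Ioo]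

open Set in
/-- If `g' / g ≤ f' / f` on `(0, r)` and `g 0 = 0`, then the weighted fundamental tone of `g` is at
most that of `f`. -/
lemma mu_le_mu_of_logDeriv_le {n : ℕ} (hn : 2 ≤ n) {r : ℝ} (hr : 0 < r) {f g : ℝ → ℝ}
    (hf : ContDiffOn ℝ 1 f (Icc 0 r)) (hg : ContDiffOn ℝ 1 g (Icc 0 r)) (hg0 : g 0 = 0)
    (hfpos : ∀ t ∈ Ioc 0 r, 0 < f t) (hgpos : ∀ t ∈ Ioc 0 r, 0 < g t)
    (hfg : ∀ t ∈ Ioo 0 r, deriv g t / g t ≤ deriv f t / f t) :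
    mu n g (Ioo 0 r) ≤ mu n f (Ioo 0 r) := by
  obtain ⟨m, rfl⟩ : ∃ m, n = m + 2 := ⟨n - 2, by omega⟩
  have hgnn : ∀ t ∈ Icc 0 r, 0 ≤ g t := by
    intro t ht
    rcases ht.1.eq_or_lt with h | h
    · rw [← h, hg0]
    · exact (hgpos t ⟨h, ht.2⟩).le
  have hwnn : ∀ t ∈ Icc 0 r, 0 ≤ g t ^ (m + 2 - 1) := fun t ht => pow_nonneg (hgnn t ht) _
  have hwc : ContinuousOn (fun t => g t ^ (m + 2 - 1)) (Icc 0 r) := hg.continuousOn.pow _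
  obtain ⟨C, hC, hwC⟩ : ∃ C : ℝ, 0 ≤ C ∧ ∀ t ∈ Icc 0 r, g t ^ (m + 2 - 1) ≤ C * t := by
    obtain ⟨K, hK⟩ := hg.exists_lipschitzOnWith (by simp) (convex_Icc 0 r) isCompact_Icc
    have hgK : ∀ t ∈ Icc 0 r, g t ≤ K * t := by
      intro t ht
      have := hK.dist_le_mul t ht 0 (left_mem_Icc.2 hr.le)
      rw [Real.dist_eq, Real.dist_eq, hg0, sub_zero, sub_zero, abs_of_nonneg ht.1] at this
      exact (le_abs_self _).trans this
    refine ⟨(K * r) ^ m * K, by positivity, fun t ht => ?_⟩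
    have h1 : g t ≤ K * r := (hgK t ht).trans (by gcongr; exact ht.2)
    have h0 := hgnn t ht
    calc g t ^ (m + 2 - 1) = g t ^ m * g t := by rw [← pow_succ]; rfl
      _ ≤ (K * r) ^ m * (K * t) := by
        gcongr
        exact hgK t ht
      _ = (K * r) ^ m * K * t := by ring
  have hnn : ∀ v : ℝ → ℝ, 0 ≤ ∫ t in (0 : ℝ)..r, v t ^ 2 * g t ^ (m + 2 - 1) := fun v =>
    intervalIntegral.integral_nonneg hr.le fun t ht => mul_nonneg (sq_nonneg _) (hwnn t ht)
  simp only [mu, setIntegral_Ioo_eq_intervalIntegral hr]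
  set Sg := { q : ℝ | ∃ φ : ℝ → ℝ, ContDiff ℝ (⊤ : ℕ∞) φ ∧ HasCompactSupport φ ∧
    tsupport φ ⊆ Ioo 0 r ∧ φ ≠ 0 ∧ q = (∫ t in (0 : ℝ)..r, deriv φ t ^ 2 * g t ^ (m + 2 - 1)) /
      ∫ t in (0 : ℝ)..r, φ t ^ 2 * g t ^ (m + 2 - 1) } with hSg
  set Sf := { q : ℝ | ∃ φ : ℝ → ℝ, ContDiff ℝ (⊤ : ℕ∞) φ ∧ HasCompactSupport φ ∧
    tsupport φ ⊆ Ioo 0 r ∧ φ ≠ 0 ∧ q = (∫ t in (0 : ℝ)..r, deriv φ t ^ 2 * f t ^ (m + 2 - 1)) /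
      ∫ t in (0 : ℝ)..r, φ t ^ 2 * f t ^ (m + 2 - 1) } with hSf
  have hSg0 : ∀ q ∈ Sg, 0 ≤ q := by
    rintro q ⟨φ, -, -, -, -, rfl⟩
    exact div_nonneg (hnn _) (hnn _)
  have hl : 0 ≤ sInf Sg := Real.sInf_nonneg hSg0
  have hP : ∀ v, IsTestFunction (Ioo 0 r) v →
      sInf Sg * ∫ t in (0 : ℝ)..r, v t ^ 2 * g t ^ (m + 2 - 1) ≤
        ∫ t in (0 : ℝ)..r, deriv v t ^ 2 * g t ^ (m + 2 - 1) := by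
    intro v hv
    rcases (hnn v).eq_or_lt with h | h
    · rw [← h, mul_zero]
      exact hnn _
    · rw [← le_div_iff₀ h]
      refine csInf_le ⟨0, hSg0⟩ ⟨v, hv.1, hv.2.1, hv.2.2, ?_, rfl⟩
      rintro rfl
      simp at h
  rcases Sf.eq_empty_or_nonempty with he | hne
  · have : Sg = ∅ := by
      rw [eq_empty_iff_forall_notMem]
      rintro q ⟨φ, h1, h2, h3, h4, -⟩
      exact eq_empty_iff_forall_notMem.1 he _ ⟨φ, h1, h2, h3, h4, rfl⟩
    rw [he, this]
  refine le_csInf hne ?_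
  rintro q ⟨φ, hφs, hφc, hφsub, hφne, rfl⟩
  have hfnn : ∀ t ∈ Ioc 0 r, 0 ≤ f t ^ (m + 2 - 1) := fun t ht => pow_nonneg (hfpos t ht).le _
  have hpos : 0 < ∫ t in (0 : ℝ)..r, φ t ^ 2 * f t ^ (m + 2 - 1) := by
    obtain ⟨c, hc⟩ := Function.ne_iff.1 hφne
    have hcI : c ∈ Ioo 0 r := hφsub (subset_tsupport φ hc)
    refine intervalIntegral.integral_pos hr
      ((hφs.continuous.pow 2).continuousOn.mul (hf.continuousOn.pow _))
      (fun t ht => mul_nonneg (sq_nonneg _) (hfnn t ht)) ⟨c, Ioo_subset_Icc_self hcI, ?_⟩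
    exact mul_pos (sq_pos_of_ne_zero hc) (pow_pos (hfpos c (Ioo_subset_Ioc_self hcI)) _)
  rw [le_div_iff₀ hpos]
  have hfd : ∀ t ∈ Ioo 0 r, HasDerivAt f (deriv f t) t := fun t ht =>
    ((hf.differentiableOn (by simp)).differentiableAt (Icc_mem_nhds ht.1 ht.2)).hasDerivAt
  have hgd : ∀ t ∈ Ioo 0 r, HasDerivAt g (deriv g t) t := fun t ht =>
    ((hg.differentiableOn (by simp)).differentiableAt (Icc_mem_nhds ht.1 ht.2)).hasDerivAt
  have hf1 := hf.mono Ioo_subset_Icc_self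
  have hg1 := hg.mono Ioo_subset_Icc_self
  have hfc' := hf1.continuousOn_deriv_of_isOpen isOpen_Ioo le_rfl
  have hgc' := hg1.continuousOn_deriv_of_isOpen isOpen_Ioo le_rfl
  have hfp : ∀ t ∈ Ioo 0 r, 0 < f t := fun t ht => hfpos t (Ioo_subset_Ioc_self ht)
  have hgp : ∀ t ∈ Ioo 0 r, 0 < g t := fun t ht => hgpos t (Ioo_subset_Ioc_self ht)
  have key := poincare_mul_monotone (φ := φ) (h := fun t => (f t / g t) ^ (m + 1))
    (h' := fun t => ((m + 1 : ℕ) : ℝ) * (f t / g t) ^ m *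
      ((deriv f t * g t - f t * deriv g t) / g t ^ 2)) hr hC hwc hwnn hwC hl hP
    (fun t ht => ((hfd t ht).div (hgd t ht) (hgp t ht).ne').pow (m + 1))
    ((continuousOn_const.mul ((hf1.continuousOn.div hg1.continuousOn
      fun t ht => (hgp t ht).ne').pow m)).mul
      (((hfc'.mul hg1.continuousOn).sub (hf1.continuousOn.mul hgc')).div (hg1.continuousOn.pow 2)
        fun t ht => (pow_pos (hgp t ht) 2).ne'))
    (fun t ht => pow_nonneg (div_pos (hfp t ht) (hgp t ht)).le _)
    (fun t ht => by
      have h1 := hfp t ht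
      have h2 := hgp t ht
      have h3 := hfg t ht
      rw [div_le_div_iff₀ h2 h1] at h3
      have h4 : 0 ≤ deriv f t * g t - f t * deriv g t := by linarith
      positivity)
    ⟨hφs, hφc, hφsub⟩
  have hcongr : ∀ v : ℝ → ℝ, (∫ t in (0 : ℝ)..r, v t ^ 2 * f t ^ (m + 2 - 1)) =
      ∫ t in (0 : ℝ)..r, v t ^ 2 * ((f t / g t) ^ (m + 1) * g t ^ (m + 2 - 1)) := by
    intro v
    refine intervalIntegral.integral_congr_ae (Filter.Eventually.of_forall fun t ht => ?_)
    rw [uIoc_of_le hr.le] at ht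
    rw [show m + 2 - 1 = m + 1 from rfl, ← mul_pow, div_mul_cancel₀ _ (hgpos t ht).ne']
  rw [hcongr φ, hcongr (deriv φ)]
  exact key

lemma contDiff_Sk (κ : ℝ) : ContDiff ℝ 1 (Sk κ) := by
  unfold Sk
  rcases lt_trichotomy κ 0 with h | h | h
  · simp only [h, if_true]
    fun_prop
  · subst h
    simp only [lt_irrefl, if_true, if_false]
    fun_prop
  · simp only [h.not_gt, h.ne', if_false]
    fun_prop

lemma Sk_zero (κ : ℝ) : Sk κ 0 = 0 := by
  simp [Sk]

lemma Sk_pos {κ r t : ℝ} (hrκ : 0 < κ → r < Real.pi / Real.sqrt κ) (ht : 0 < t) (htr : t ≤ r) :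
    0 < Sk κ t := by
  unfold Sk
  split_ifs with h1 h2
  · have : 0 < Real.sqrt (-κ) := Real.sqrt_pos.2 (by linarith)
    exact div_pos (Real.sinh_pos_iff.2 (by positivity)) this
  · exact ht
  · have hκ : 0 < κ := lt_of_le_of_ne (not_lt.1 h1) (Ne.symm h2)
    have hs : 0 < Real.sqrt κ := Real.sqrt_pos.2 hκ
    have h3 := htr.trans_lt (hrκ hκ)
    rw [lt_div_iff₀ hs, mul_comm] at h3
    exact div_pos (Real.sin_pos_of_pos_of_lt_pi (by positivity) h3) hs

/-- Theorem 1.1 for rotationally symmetric metrics: let `f : [0,r] → ℝ` be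
smooth with `f(0) = 0`, `f'(0) = 1`, `f > 0` on `(0,r]`, where `r < π/√κ` if `κ > 0`.
If `f'/f ≥ S_κ'/S_κ` on `(0,r)` then `μ_n(f, r) ≥ μ_n(S_κ, r)`; if `f'/f ≤ S_κ'/S_κ`
on `(0,r)` then `μ_n(f, r) ≤ μ_n(S_κ, r)`. -/
theorem stmt5 (n : ℕ) (hn : 2 ≤ n) (κ : ℝ) (r : ℝ) (hr : 0 < r)
    (hrκ : 0 < κ → r < Real.pi / Real.sqrt κ)
    (f : ℝ → ℝ) (hf : ContDiffOn ℝ (⊤ : ℕ∞) f (Set.Icc 0 r)) (hf0 : f 0 = 0)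
    (hf'0 : derivWithin f (Set.Icc 0 r) 0 = 1) (hfpos : ∀ t ∈ Set.Ioc 0 r, 0 < f t) :
    ((∀ t ∈ Set.Ioo 0 r, deriv (Sk κ) t / Sk κ t ≤ derivWithin f (Set.Icc 0 r) t / f t) →
        mu n (Sk κ) (Set.Ioo 0 r) ≤ mu n f (Set.Ioo 0 r)) ∧
    ((∀ t ∈ Set.Ioo 0 r, derivWithin f (Set.Icc 0 r) t / f t ≤ deriv (Sk κ) t / Sk κ t) →
        mu n f (Set.Ioo 0 r) ≤ mu n (Sk κ) (Set.Ioo 0 r)) := by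
  have hf1 : ContDiffOn ℝ 1 f (Set.Icc 0 r) := hf.of_le (by simp)
  have hS1 : ContDiffOn ℝ 1 (Sk κ) (Set.Icc 0 r) := (contDiff_Sk κ).contDiffOn
  have hSpos : ∀ t ∈ Set.Ioc 0 r, 0 < Sk κ t := fun t ht => Sk_pos hrκ ht.1 ht.2
  have hd : ∀ t ∈ Set.Ioo 0 r, derivWithin f (Set.Icc 0 r) t = deriv f t := fun t ht =>
    derivWithin_of_mem_nhds (Icc_mem_nhds ht.1 ht.2)
  refine ⟨fun h => ?_, fun h => ?_⟩
  · exact mu_le_mu_of_logDeriv_le hn hr hf1 hS1 (Sk_zero κ) hfpos hSpos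
      fun t ht => hd t ht ▸ h t ht
  · exact mu_le_mu_of_logDeriv_le hn hr hS1 hf1 hf0 hSpos hfpos
      fun t ht => hd t ht ▸ h t ht
end
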